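/- Assume Condition (A): there is a matrix function c₊(x,t) on ℝ²×closure(D⁺), smooth, with det c₊(x,t)≠0 everywhere, analytic in t on D⁺ and at t=∞ with det c₊(x,∞)≠0, satisfying ζ(t)·∂c₊/∂x = −i(A₁(x)ζ₁(t)+A₂(x)ζ₂(t))c₊ and c₊(x,t)→I_m as |x|→∞, where A₁,A₂ are C^∞ and O(e^{−δ|x|}) with all derivatives. Let V be C^∞ and O(e^{−δ|x|}) with all derivatives, and define B₊(x,t) = c₊(x,t)·(Π(t)(c₊(·,t)^{-1}Vc₊(·,t)))(x)·c₊(x,t)^{-1}. Then for every ρ>1 and every x∈ℝ²: (1/(2πi))∮_{|t|=ρ} B₊(x,t) dt = c₊(x,∞)·(S(c₊(·,∞)^{-1}Vc₊(·,∞)))(x)·c₊(x,∞)^{-1}, and consequently V(x) = c₊(x,∞)·[ ∂/∂z̄ ( c₊(x,∞)^{-1} I(x) c₊(x,∞) ) ]·c₊(x,∞)^{-1}, where I(x) = (1/(2πi))∮_{|t|=ρ} B₊(x,t) dt. -/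

import Mathlib

noncomputable section

open MeasureTheory Filter Topology Complex Matrix

abbrev R2 : Type := EuclideanSpace ℝ (Fin 2)
abbrev Mat (m : ℕ) : Type := Matrix (Fin m) (Fin m) ℂ
abbrev Vec (m : ℕ) : Type := Fin m → ℂ

/-- the point (a,b) ∈ ℝ² -/
def mk2 (a b : ℝ) : R2 := (WithLp.equiv 2 (Fin 2 → ℝ)).symm ![a, b]
def e1 : R2 := mk2 1 0
def e2 : R2 := mk2 0 1

/-- partial derivative of a scalar function in direction v -/
def pdv (v : R2) (f : R2 → ℂ) (x : R2) : ℂ := fderiv ℝ f x v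

def zeta1 (t : ℂ) : ℂ := (t + t⁻¹) / 2
def zeta2 (t : ℂ) : ℂ := (t - t⁻¹) / (2 * Complex.I)

/-- z = x₁ + i x₂ -/
def zOf (x : R2) : ℂ := (x 0 : ℂ) + Complex.I * (x 1 : ℂ)

/-- the kernel denominator t(z−z′)+t⁻¹(z̄−z̄′) -/
def ker (t : ℂ) (x y : R2) : ℂ :=
  t * (zOf x - zOf y) + t⁻¹ * (starRingEnd ℂ) (zOf x - zOf y)

/-- ζ·∂c/∂x for a matrix-valued function, entrywise -/
def zDirM {m : ℕ} (z1 z2 : ℂ) (c : R2 → Mat m) (x : R2) : Mat m :=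
  Matrix.of fun i j => z1 * pdv e1 (fun y => c y i j) x + z2 * pdv e2 (fun y => c y i j) x

def zDirV {m : ℕ} (z1 z2 : ℂ) (u : R2 → Vec m) (x : R2) : Vec m :=
  fun i => z1 * pdv e1 (fun y => u y i) x + z2 * pdv e2 (fun y => u y i) x

/-- ∂/∂z̄ of a matrix-valued function -/
def dzbarM {m : ℕ} (c : R2 → Mat m) (x : R2) : Mat m :=
  Matrix.of fun i j =>
    (pdv e1 (fun y => c y i j) x + Complex.I * pdv e2 (fun y => c y i j) x) / 2

def dzbarV {m : ℕ} (u : R2 → Vec m) (x : R2) : Vec m :=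
  fun i => (pdv e1 (fun y => u y i) x + Complex.I * pdv e2 (fun y => u y i) x) / 2

def dzM {m : ℕ} (c : R2 → Mat m) (x : R2) : Mat m :=
  Matrix.of fun i j =>
    (pdv e1 (fun y => c y i j) x - Complex.I * pdv e2 (fun y => c y i j) x) / 2

/-- the operator Π(t), matrix-valued version -/
def PiTM {m : ℕ} (t : ℂ) (f : R2 → Mat m) (x : R2) : Mat m :=
  Matrix.of fun i j => (Real.pi : ℂ)⁻¹ * ∫ y : R2, f y i j / ker t x y

def PiTV {m : ℕ} (t : ℂ) (f : R2 → Vec m) (x : R2) : Vec m :=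
  fun i => (Real.pi : ℂ)⁻¹ * ∫ y : R2, f y i / ker t x y

/-- the Cauchy transform S -/
def CauchyM {m : ℕ} (f : R2 → Mat m) (x : R2) : Mat m :=
  Matrix.of fun i j => (Real.pi : ℂ)⁻¹ * ∫ y : R2, f y i j / (zOf x - zOf y)

def CauchyV {m : ℕ} (f : R2 → Vec m) (x : R2) : Vec m :=
  fun i => (Real.pi : ℂ)⁻¹ * ∫ y : R2, f y i / (zOf x - zOf y)

/-- the contour integral ∮_{|t|=ρ} F(t) dt -/
def circIntM {m : ℕ} (F : ℂ → Mat m) (ρ : ℝ) : Mat m :=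
  Matrix.of fun i j => ∫ φ in (0:ℝ)..(2*Real.pi),
    F ((ρ:ℂ) * Complex.exp (Complex.I * φ)) i j * (Complex.I * ρ * Complex.exp (Complex.I * φ))

def circIntV {m : ℕ} (F : ℂ → Vec m) (ρ : ℝ) : Vec m :=
  fun i => ∫ φ in (0:ℝ)..(2*Real.pi),
    F ((ρ:ℂ) * Complex.exp (Complex.I * φ)) i * (Complex.I * ρ * Complex.exp (Complex.I * φ))

def MatSmooth {m : ℕ} (c : R2 → Mat m) : Prop := ∀ i j, ContDiff ℝ (⊤ : ℕ∞) (fun x => c x i j)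

def SuppIn {m : ℕ} (A : R2 → Mat m) (R : ℝ) : Prop := ∀ x : R2, R ≤ ‖x‖ → A x = 0

/-- A(x,ζ) = ζ₁A₁(x)+ζ₂A₂(x)+A₀(x) -/
def Acomb {m : ℕ} (A0 A1 A2 : R2 → Mat m) (z1 z2 : ℂ) (x : R2) : Mat m :=
  z1 • A1 x + z2 • A2 x + A0 x

/-- c solves θ·∂c/∂x = M(x)c along every line in direction θ -/
def Transport {m : ℕ} (M : R2 → Mat m) (θ : R2) (c : R2 → Mat m) : Prop :=
  ∀ x : R2, ∀ i j, HasDerivAt (fun s : ℝ => c (x + s • θ) i j) ((M x * c x) i j) 0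

open Classical in
/-- extension at infinity: `extInf F L` equals `F (1/s)` for `s ≠ 0` and `L` at `s = 0`;
analyticity of this at `0` encodes analyticity of `F` at `t = ∞` with value `L`. -/
def extInf {m : ℕ} (F : ℂ → Mat m) (L : Mat m) (s : ℂ) : Mat m := if s = 0 then L else F s⁻¹
/-- smooth with all derivatives O(e^{−δ|x|}) -/
def ExpDecay {m : ℕ} (δ : ℝ) (A : R2 → Mat m) : Prop :=
  ∀ i j, ContDiff ℝ (⊤ : ℕ∞) (fun x => A x i j) ∧
    ∀ n : ℕ, ∃ C : ℝ, ∀ x : R2,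
      ‖iteratedFDeriv ℝ n (fun y => A y i j) x‖ ≤ C * Real.exp (-δ * ‖x‖)

open Set Metric in
theorem integrableOn_ball_norm_inv (r : ℝ) :
    IntegrableOn (fun w : ℂ => ‖w‖⁻¹) (ball 0 r) := by
  rw [integrableOn_fun_norm_addHaar volume (f := fun y : ℝ => y⁻¹)]
  have h : IntegrableOn (fun _ : ℝ => (1 : ℝ)) (Ioo 0 r) := by simp
  refine h.congr_fun (fun y hy => ?_) measurableSet_Ioo
  have : y ≠ 0 := hy.1.ne'
  simp [this]

theorem locallyIntegrable_complex_inv : LocallyIntegrable (fun w : ℂ => w⁻¹) := by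
  intro x
  refine ⟨Metric.ball 0 (‖x‖ + 1), Metric.isOpen_ball.mem_nhds (by simp), ?_⟩
  refine (integrableOn_ball_norm_inv (‖x‖ + 1)).mono' ?_ ?_
  · exact (measurable_id.inv : Measurable fun w : ℂ => w⁻¹).aestronglyMeasurable
  · exact .of_forall fun w => by simp

theorem integrable_exp_neg_mul_norm {δ : ℝ} (hδ : 0 < δ) :
    Integrable (fun w : ℂ => Real.exp (-δ * ‖w‖)) := by
  rw [integrable_fun_norm_addHaar volume (f := fun y : ℝ => Real.exp (-δ * y))]
  have h := integrableOn_rpow_mul_exp_neg_mul_rpow (p := 1) (s := 1) (b := δ) (by norm_num)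
    zero_lt_one hδ
  simpa using h

theorem integrable_exp_neg_mul_norm_mul_inv {δ : ℝ} (hδ : 0 < δ) (z : ℂ) :
    Integrable (fun w : ℂ => Real.exp (-δ * ‖w‖) * ‖z - w‖⁻¹) := by
  have h1 : Integrable (fun w : ℂ => (Metric.ball (0 : ℂ) 1).indicator (fun w => ‖w‖⁻¹) (z - w)) :=
    ((integrable_indicator_iff Metric.isOpen_ball.measurableSet).2
      (integrableOn_ball_norm_inv 1)).comp_sub_left z
  refine (h1.add (integrable_exp_neg_mul_norm hδ)).mono' ?_ (.of_forall fun w => ?_)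
  · apply Measurable.aestronglyMeasurable
    fun_prop
  · have hexp : Real.exp (-δ * ‖w‖) ≤ 1 := Real.exp_le_one_iff.2 (by
      nlinarith [norm_nonneg w])
    rw [Real.norm_of_nonneg (by positivity)]
    by_cases hw : z - w ∈ Metric.ball (0 : ℂ) 1
    · simp only [Pi.add_apply, Set.indicator_of_mem hw]
      have := Real.exp_pos (-δ * ‖w‖)
      have : 0 ≤ ‖z - w‖⁻¹ := by positivity
      nlinarith
    · simp only [Pi.add_apply, Set.indicator_of_notMem hw, zero_add]
      have : 1 ≤ ‖z - w‖ := by simpa using hw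
      exact mul_le_of_le_one_right (Real.exp_pos _).le (inv_le_one_of_one_le₀ this)

open Set in
/-- The Cauchy–Pompeiu formula for compactly supported functions, at the origin. -/
theorem integral_inv_mul_dbar {U : ℂ → ℂ} (hU : ContDiff ℝ 1 U) (hc : HasCompactSupport U) :
    ∫ w : ℂ, w⁻¹ * (fderiv ℝ U w 1 + Complex.I * fderiv ℝ U w Complex.I) =
      -(2 * Real.pi * U 0) := by
  set e : ℝ → ℂ := fun θ => Real.cos θ + Real.sin θ * Complex.I with he
  have hecont : Continuous e := by fun_prop
  have henorm : ∀ θ, ‖e θ‖ = 1 := fun θ => by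
    rw [he]; push_cast
    exact Complex.norm_cos_add_sin_mul_I θ
  have hDcont : Continuous (fderiv ℝ U) := hU.continuous_fderiv one_ne_zero
  have hdiff : Differentiable ℝ U := hU.differentiable one_ne_zero
  obtain ⟨R, hR⟩ : ∃ R : ℝ, ∀ w : ℂ, R < ‖w‖ → w ∉ tsupport U := by
    obtain ⟨R, hR⟩ := hc.isCompact.isBounded.exists_norm_le
    exact ⟨R, fun w hw h => absurd (hR w h) (not_le.2 hw)⟩
  have hU0 : ∀ w : ℂ, R < ‖w‖ → U w = 0 := fun w hw => image_eq_zero_of_notMem_tsupport (hR w hw)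
  have hDU0 : ∀ w : ℂ, R < ‖w‖ → fderiv ℝ U w = 0 := fun w hw =>
    Function.notMem_support.1 fun h => hR w hw (support_fderiv_subset ℝ h)
  -- integrability of continuous functions vanishing for large radius
  have hint : ∀ F : ℝ × ℝ → ℂ, Continuous F → (∀ r θ, 0 < r → R < r → F (r, θ) = 0) →
      IntegrableOn F (Ioi 0 ×ˢ Ioo (-Real.pi) Real.pi) := by
    intro F hF h0
    have h1 : IntegrableOn F (Icc 0 R ×ˢ Icc (-Real.pi) Real.pi) :=
      hF.continuousOn.integrableOn_compact (isCompact_Icc.prod isCompact_Icc)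
    refine (h1.of_forall_sdiff_eq_zero (t := Ioi 0 ×ˢ Ioo (-Real.pi) Real.pi)
      (measurableSet_Ioi.prod measurableSet_Ioo) ?_)
    rintro ⟨r, θ⟩ ⟨⟨hr, hθ⟩, hn⟩
    refine h0 r θ hr ?_
    by_contra hle
    exact hn ⟨⟨le_of_lt hr, not_lt.1 hle⟩, Ioo_subset_Icc_self hθ⟩
  set F1 : ℝ × ℝ → ℂ := fun p => fderiv ℝ U (p.1 * e p.2) (e p.2) with hF1
  set F2 : ℝ × ℝ → ℂ := fun p => fderiv ℝ U (p.1 * e p.2) (Complex.I * e p.2) with hF2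
  have hF1c : Continuous F1 := by
    refine (hDcont.comp ?_).clm_apply ?_ <;> fun_prop
  have hF2c : Continuous F2 := by
    refine (hDcont.comp ?_).clm_apply ?_ <;> fun_prop
  have hnorm : ∀ r θ : ℝ, 0 < r → ‖(r : ℂ) * e θ‖ = r := fun r θ hr => by
    rw [norm_mul, henorm, mul_one, Complex.norm_real, Real.norm_of_nonneg hr.le]
  have hF1i := hint F1 hF1c fun r θ h0 hr => by
    simp [hF1, hDU0 _ (by rw [hnorm r θ h0]; exact hr)]
  have hF2i := hint F2 hF2c fun r θ h0 hr => by
    simp [hF2, hDU0 _ (by rw [hnorm r θ h0]; exact hr)]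
  have hpolar : ∫ w : ℂ, w⁻¹ * (fderiv ℝ U w 1 + Complex.I * fderiv ℝ U w Complex.I) =
      ∫ p in Ioi (0 : ℝ) ×ˢ Ioo (-Real.pi) Real.pi, (F1 p + Complex.I * F2 p) := by
    rw [← Complex.integral_comp_polarCoord_symm]
    refine setIntegral_congr_fun (measurableSet_Ioi.prod measurableSet_Ioo) ?_
    rintro ⟨r, θ⟩ ⟨hr, -⟩
    have hr : (0 : ℝ) < r := hr
    have hr' : (r : ℂ) ≠ 0 := by exact_mod_cast hr.ne'
    have hz : Complex.polarCoord.symm (r, θ) = r * e θ := by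
      simp [he]
    have hlin : ∀ L : ℂ →L[ℝ] ℂ, L (e θ) = Real.cos θ * L 1 + Real.sin θ * L Complex.I := by
      intro L
      have : e θ = Real.cos θ • (1 : ℂ) + Real.sin θ • Complex.I := by simp [he]
      rw [this, map_add, map_smul, map_smul]; simp
    have hlin' : ∀ L : ℂ →L[ℝ] ℂ, L (Complex.I * e θ) =
        Real.cos θ * L Complex.I - Real.sin θ * L 1 := by
      intro L
      have : Complex.I * e θ = Real.cos θ • Complex.I - Real.sin θ • (1 : ℂ) := by
        simp only [he, Complex.real_smul]
        linear_combination (Real.sin θ : ℂ) * Complex.I_mul_I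
      rw [this, map_sub, map_smul, map_smul]; simp
    have hene : e θ ≠ 0 := by
      intro h; have := henorm θ; simp [h] at this
    have hinv : (e θ)⁻¹ = Real.cos θ - Real.sin θ * Complex.I := by
      rw [inv_eq_iff_eq_inv, eq_comm, inv_eq_iff_eq_inv, eq_comm]
      refine inv_eq_of_mul_eq_one_right ?_
      have := Complex.cos_sq_add_sin_sq (θ : ℂ)
      simp only [he]; push_cast
      linear_combination this - (Complex.sin θ)^2 * Complex.I_mul_I
    simp only [hz, hF1, hF2, hlin, hlin', Complex.real_smul, mul_inv, hinv]
    field_simp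
    linear_combination (-(Real.sin θ : ℂ) * fderiv ℝ U (r * e θ) Complex.I) * Complex.I_mul_I
  rw [hpolar, integral_add hF1i (hF2i.const_mul _), integral_const_mul]
  have hrad : ∀ θ r : ℝ, HasDerivAt (fun r : ℝ => U (r * e θ)) (F1 (r, θ)) r := by
    intro θ r
    have h1 : HasDerivAt (fun r : ℝ => (r : ℂ) * e θ) (e θ) r := by
      simpa using (Complex.ofRealCLM.hasDerivAt (x := r)).mul_const (e θ)
    exact (hdiff _).hasFDerivAt.comp_hasDerivAt r h1
  have hang : ∀ r θ : ℝ, HasDerivAt (fun θ : ℝ => U (r * e θ)) (r * F2 (r, θ)) θ := by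
    intro r θ
    have h1 : HasDerivAt e (Complex.I * e θ) θ := by
      have hc := (Real.hasDerivAt_cos θ).ofReal_comp
      have hs := (Real.hasDerivAt_sin θ).ofReal_comp.mul_const Complex.I
      refine (hc.add hs).congr_deriv ?_
      simp only [he]; push_cast
      linear_combination (-Complex.sin θ) * Complex.I_mul_I
    have h2 := (hdiff _).hasFDerivAt.comp_hasDerivAt θ (h1.const_mul (r : ℂ))
    refine h2.congr_deriv ?_
    rw [← Complex.real_smul (x := r) (z := Complex.I * e θ), map_smul, Complex.real_smul]
  have hI1 : ∫ p in Ioi (0 : ℝ) ×ˢ Ioo (-Real.pi) Real.pi, F1 p = -(2 * Real.pi * U 0) := by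
    have hinner : ∀ θ : ℝ, ∫ r in Ioi (0 : ℝ), F1 (r, θ) = -U 0 := by
      intro θ
      have hzero : ∀ r : ℝ, r ∉ Icc 0 R → r ∈ Ioi (0 : ℝ) → F1 (r, θ) = 0 := by
        intro r hn hr
        have hr : (0 : ℝ) < r := hr
        have hlt : R < r := by
          by_contra hle
          exact hn ⟨hr.le, not_lt.1 hle⟩
        simp [hF1, hDU0 _ (by rw [hnorm r θ hr]; exact hlt)]
      have hi : IntegrableOn (fun r => F1 (r, θ)) (Ioi 0) := by
        have h1 : IntegrableOn (fun r => F1 (r, θ)) (Icc 0 R) :=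
          (Continuous.continuousOn (by fun_prop)).integrableOn_compact isCompact_Icc
        exact h1.of_forall_sdiff_eq_zero measurableSet_Ioi fun r hr => hzero r hr.2 hr.1
      have ht : Filter.Tendsto (fun r : ℝ => U (r * e θ)) Filter.atTop (𝓝 0) := by
        refine tendsto_const_nhds.congr' ?_
        filter_upwards [Filter.eventually_gt_atTop R, Filter.eventually_gt_atTop 0] with r hr h0
        rw [hU0 _ (by rw [hnorm r θ h0]; exact hr)]
      rw [integral_Ioi_of_hasDerivAt_of_tendsto' (fun r _ => hrad θ r) hi ht]
      simp
    rw [Measure.volume_eq_prod, ← Measure.prod_restrict, integral_prod_symm]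
    · simp only [hinner]
      have hvol : (volume.restrict (Ioo (-Real.pi) Real.pi)).real univ = 2 * Real.pi := by
        rw [measureReal_restrict_apply_univ, Real.volume_real_Ioo_of_le (by linarith [Real.pi_pos])]
        ring
      rw [integral_const, hvol, Complex.real_smul]
      push_cast
      ring
    · rwa [Measure.prod_restrict, ← Measure.volume_eq_prod]
  have hI2 : ∫ p in Ioi (0 : ℝ) ×ˢ Ioo (-Real.pi) Real.pi, F2 p = 0 := by
    rw [Measure.volume_eq_prod, setIntegral_prod]
    · refine setIntegral_eq_zero_of_forall_eq_zero fun r hr => ?_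
      have hr' : (r : ℂ) ≠ 0 := by exact_mod_cast (ne_of_gt hr)
      rw [← integral_Ioc_eq_integral_Ioo, ← intervalIntegral.integral_of_le
        (by linarith [Real.pi_pos])]
      have h := intervalIntegral.integral_eq_sub_of_hasDerivAt (fun θ _ => hang r θ)
        (a := -Real.pi) (b := Real.pi) (Continuous.intervalIntegrable (by fun_prop) _ _)
      rw [intervalIntegral.integral_const_mul] at h
      have h3 : (r : ℂ) * ∫ θ in -Real.pi..Real.pi, F2 (r, θ) = 0 := by
        rw [h]; simp [he]
      exact (mul_eq_zero.1 h3).resolve_left hr'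
    · rwa [← Measure.volume_eq_prod]
  rw [hI1, hI2]; simp

theorem hasFDerivAt_cauchy_of_hasCompactSupport {H : ℂ → ℂ} (hH : ContDiff ℝ 1 H)
    (hc : HasCompactSupport H) (z : ℂ) :
    ∃ L : ℂ →L[ℝ] ℂ, HasFDerivAt (fun z => ∫ w : ℂ, H w / (z - w)) L z ∧
      L 1 + Complex.I * L Complex.I = 2 * Real.pi * H z := by
  have hfun : (fun z => ∫ w : ℂ, H w / (z - w)) =
      convolution (fun w : ℂ => w⁻¹) H (ContinuousLinearMap.mul ℝ ℂ) volume := by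
    funext z
    rw [convolution_def, ← integral_sub_left_eq_self _ volume z]
    simp [div_eq_inv_mul]
  have hd := hc.hasFDerivAt_convolution_right (ContinuousLinearMap.mul ℝ ℂ)
    locallyIntegrable_complex_inv hH z
  refine ⟨_, hfun ▸ hd, ?_⟩
  have hD : Continuous (fderiv ℝ H) := hH.continuous_fderiv one_ne_zero
  rw [convolution_precompR_apply _ locallyIntegrable_complex_inv (hc.fderiv ℝ) hD,
    convolution_precompR_apply _ locallyIntegrable_complex_inv (hc.fderiv ℝ) hD]
  have hint : ∀ v : ℂ, Integrable fun t : ℂ => t⁻¹ * fderiv ℝ H (z - t) v := fun v =>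
    ((hc.fderiv_apply ℝ v).convolutionExists_right (ContinuousLinearMap.mul ℝ ℂ)
      locallyIntegrable_complex_inv (hD.clm_apply continuous_const)) z
  set U : ℂ → ℂ := fun t => H (z - t) with hU
  have hUd : ContDiff ℝ 1 U := hH.comp (contDiff_const.sub contDiff_id)
  have hUc : HasCompactSupport U := hc.comp_homeomorph (Homeomorph.subLeft z)
  have hUf : ∀ t, fderiv ℝ U t = -fderiv ℝ H (z - t) := fun t => by
    have h := ((hH.differentiable one_ne_zero) (z - t)).hasFDerivAt.comp t
      ((hasFDerivAt_id (𝕜 := ℝ) t).const_sub z)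
    refine h.fderiv.trans ?_
    ext; simp
  have key := integral_inv_mul_dbar hUd hUc
  have hU0 : U 0 = H z := by simp [hU]
  simp only [hUf, hU0, _root_.neg_apply] at key
  simp only [convolution_def, ContinuousLinearMap.mul_apply']
  rw [← integral_const_mul, ← integral_add (hint 1) ((hint Complex.I).const_mul _),
    ← neg_inj, ← key, ← integral_neg]
  congr 1 with t
  ring

theorem hasDerivAt_cauchy_of_eq_zero {H : ℂ → ℂ} (hH : Integrable H) {z : ℂ}
    (h0 : ∀ w ∈ Metric.ball z 1, H w = 0) :
    ∃ c : ℂ, HasDerivAt (fun z => ∫ w : ℂ, H w / (z - w)) c z := by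
  have hmeas : ∀ x : ℂ, AEStronglyMeasurable (fun w => H w / (x - w)) := fun x =>
    hH.aestronglyMeasurable.mul
      (by fun_prop : Measurable fun w : ℂ => (x - w)⁻¹).aestronglyMeasurable
  have hdist : ∀ x ∈ Metric.ball z (1 / 2), ∀ w, H w ≠ 0 → 1 / 2 ≤ ‖x - w‖ := by
    intro x hx w hw
    have h1 : 1 ≤ dist w z := by
      by_contra h
      exact hw (h0 w (not_le.1 h))
    have h2 : dist x z < 1 / 2 := hx
    have h3 := dist_triangle w x z
    rw [← dist_eq_norm, dist_comm]
    linarith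
  refine ⟨_, (hasDerivAt_integral_of_dominated_loc_of_deriv_le
    (F := fun x w => H w / (x - w)) (F' := fun x w => -(H w / (x - w) ^ 2))
    (bound := fun w => 4 * ‖H w‖) (Metric.ball_mem_nhds z (by norm_num : (0 : ℝ) < 1 / 2))
    (.of_forall hmeas) ?_ ?_ (.of_forall fun w x hx => ?_) (hH.norm.const_mul 4)
    (.of_forall fun w x hx => ?_)).2⟩
  · refine (hH.norm.const_mul 2).mono' (hmeas z) (.of_forall fun w => ?_)
    by_cases hw : H w = 0
    · simp [hw]
    have h := hdist z (Metric.mem_ball_self (by norm_num)) w hw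
    rw [norm_div, div_le_iff₀ (by linarith)]
    nlinarith [norm_nonneg (H w)]
  · exact (hH.aestronglyMeasurable.mul (by fun_prop : Measurable fun w : ℂ =>
      ((z - w) ^ 2)⁻¹).aestronglyMeasurable).neg
  · by_cases hw : H w = 0
    · simp [hw]
    have h := hdist x hx w hw
    rw [norm_neg, norm_div, norm_pow, div_le_iff₀ (by positivity)]
    have : 1 / 4 ≤ ‖x - w‖ ^ 2 := by nlinarith
    nlinarith [norm_nonneg (H w)]
  · by_cases hw : H w = 0
    · simpa [hw] using hasDerivAt_const x (0 : ℂ)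
    have h := hdist x hx w hw
    have hne : x - w ≠ 0 := by
      intro h'; rw [h'] at h; norm_num at h
    have := (hasDerivAt_const x (H w)).div ((hasDerivAt_id x).sub_const w) hne
    refine this.congr_deriv ?_
    simp; ring

/-- The Cauchy transform inverts the `∂̄` operator. -/
theorem hasFDerivAt_cauchy {G : ℂ → ℂ} (hG : ContDiff ℝ 1 G) {C δ : ℝ} (hδ : 0 < δ)
    (hb : ∀ w, ‖G w‖ ≤ C * Real.exp (-δ * ‖w‖)) (z : ℂ) :
    ∃ L : ℂ →L[ℝ] ℂ, HasFDerivAt (fun z => ∫ w : ℂ, G w / (z - w)) L z ∧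
      L 1 + Complex.I * L Complex.I = 2 * Real.pi * G z := by
  have hdiv : ∀ (F : ℂ → ℂ), Continuous F → (∀ w, ‖F w‖ ≤ C * Real.exp (-δ * ‖w‖)) →
      ∀ z, Integrable fun w => F w / (z - w) := by
    intro F hF hb z
    refine ((integrable_exp_neg_mul_norm_mul_inv hδ z).const_mul C).mono' ?_
      (.of_forall fun w => ?_)
    · exact (hF.measurable.div (by fun_prop)).aestronglyMeasurable
    · rw [norm_div, div_eq_mul_inv, ← mul_assoc]
      exact mul_le_mul_of_nonneg_right (hb w) (by positivity)
  let χ : ContDiffBump z := ⟨1, 2, one_pos, one_lt_two⟩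
  have hχd : ContDiff ℝ 1 (fun w => ((χ w : ℝ) : ℂ)) := Complex.ofRealCLM.contDiff.comp χ.contDiff
  have hχn : ∀ w, ‖((χ w : ℝ) : ℂ)‖ ≤ 1 := fun w => by
    rw [Complex.norm_real, Real.norm_of_nonneg χ.nonneg]; exact χ.le_one
  have hχn' : ∀ w, ‖1 - ((χ w : ℝ) : ℂ)‖ ≤ 1 := fun w => by
    rw [← Complex.ofReal_one, ← Complex.ofReal_sub, Complex.norm_real,
      Real.norm_of_nonneg (sub_nonneg.2 χ.le_one)]
    linarith [χ.nonneg (x := w)]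
  set H0 : ℂ → ℂ := fun w => χ w * G w
  set H1 : ℂ → ℂ := fun w => (1 - χ w) * G w
  have hH0 : ContDiff ℝ 1 H0 := hχd.mul hG
  have hH1 : ContDiff ℝ 1 H1 := (contDiff_const.sub hχd).mul hG
  have hb0 : ∀ w, ‖H0 w‖ ≤ C * Real.exp (-δ * ‖w‖) := fun w => by
    rw [norm_mul]
    exact (mul_le_of_le_one_left (norm_nonneg _) (hχn w)).trans (hb w)
  have hb1 : ∀ w, ‖H1 w‖ ≤ C * Real.exp (-δ * ‖w‖) := fun w => by
    rw [norm_mul]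
    exact (mul_le_of_le_one_left (norm_nonneg _) (hχn' w)).trans (hb w)
  have hc0 : HasCompactSupport H0 := by
    have : HasCompactSupport fun w => ((χ w : ℝ) : ℂ) :=
      χ.hasCompactSupport.comp_left (g := fun r : ℝ => (r : ℂ)) Complex.ofReal_zero
    exact this.mul_right
  have hz0 : H0 z = G z := by
    have : χ z = 1 := χ.one_of_mem_closedBall (Metric.mem_closedBall_self (by positivity))
    simp [H0, this]
  have hi1 : Integrable H1 := ((integrable_exp_neg_mul_norm hδ).const_mul C).mono'
    hH1.continuous.aestronglyMeasurable (.of_forall hb1)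
  obtain ⟨L, hL, hLz⟩ := hasFDerivAt_cauchy_of_hasCompactSupport hH0 hc0 z
  obtain ⟨c, hcd⟩ := hasDerivAt_cauchy_of_eq_zero hi1 (z := z) fun w hw => by
    have : χ w = 1 := χ.one_of_mem_closedBall (Metric.ball_subset_closedBall hw)
    simp [H1, this]
  have hsum : (fun z => ∫ w : ℂ, G w / (z - w)) =
      fun z => (∫ w : ℂ, H0 w / (z - w)) + ∫ w : ℂ, H1 w / (z - w) := by
    funext x
    rw [← integral_add (hdiv H0 hH0.continuous hb0 x) (hdiv H1 hH1.continuous hb1 x)]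
    congr 1 with w
    simp only [H0, H1]; ring
  rw [hsum]
  refine ⟨_, hL.add (hcd.hasFDerivAt.restrictScalars ℝ), ?_⟩
  rw [← hz0, ← hLz]
  simp
  linear_combination c * Complex.I_mul_I

/-- The isometric identification of `ℝ²` with `ℂ`. -/
def zIso : R2 ≃ₗᵢ[ℝ] ℂ := Complex.orthonormalBasisOneI.repr.symm

theorem zIso_apply (x : R2) : zIso x = zOf x := by
  simp [zIso, zOf, mul_comm]

theorem zIso_e1 : zIso e1 = 1 := by
  simp [zIso_apply, zOf, e1, mk2]

theorem zIso_e2 : zIso e2 = Complex.I := by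
  simp [zIso_apply, zOf, e2, mk2]

theorem zOf_sub_ne_zero {x y : R2} (h : x ≠ y) : zOf x - zOf y ≠ 0 := by
  rw [← zIso_apply, ← zIso_apply, sub_ne_zero]
  exact fun h' => h (zIso.injective h')

theorem continuous_zOf : Continuous zOf := by
  have : zOf = zIso := funext fun x => (zIso_apply x).symm
  rw [this]; exact zIso.continuous

theorem integrable_exp_neg_mul_norm_mul_inv_zOf {δ : ℝ} (hδ : 0 < δ) (x : R2) :
    Integrable (fun y : R2 => Real.exp (-δ * ‖y‖) * ‖zOf x - zOf y‖⁻¹) := by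
  have h := (zIso.measurePreserving.integrable_comp_emb
    zIso.toHomeomorph.measurableEmbedding).2 (integrable_exp_neg_mul_norm_mul_inv hδ (zOf x))
  refine h.congr (.of_forall fun y => ?_)
  simp [zIso_apply, ← zIso.norm_map y]

/-- The normalised Cauchy transform is a right inverse of `∂̄`. -/
theorem dzbarM_CauchyM {m : ℕ} {G : R2 → Mat m} (hG : ∀ i j, ContDiff ℝ 1 fun x => G x i j)
    {C δ : ℝ} (hδ : 0 < δ) (hb : ∀ x i j, ‖G x i j‖ ≤ C * Real.exp (-δ * ‖x‖)) (x : R2) :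
    dzbarM (CauchyM G) x = G x := by
  ext i j
  have hz : ∀ w : ℂ, zOf (zIso.symm w) = w := fun w => by
    rw [← zIso_apply, zIso.apply_symm_apply]
  obtain ⟨L, hL, hLz⟩ := hasFDerivAt_cauchy (G := fun w => G (zIso.symm w) i j)
    ((hG i j).comp zIso.symm.contDiff) hδ (fun w => by simpa using hb (zIso.symm w) i j) (zOf x)
  have hfun : ∀ y : R2, (CauchyM G y) i j =
      (Real.pi : ℂ)⁻¹ * ∫ w : ℂ, G (zIso.symm w) i j / (zIso y - w) := by
    intro y
    rw [← zIso.measurePreserving.integral_comp zIso.toHomeomorph.measurableEmbedding]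
    simp [CauchyM, ← zIso_apply]
  have hd : HasFDerivAt (fun y => (CauchyM G y) i j)
      ((Real.pi : ℂ)⁻¹ • L.comp (zIso.toContinuousLinearEquiv : R2 →L[ℝ] ℂ)) x := by
    simp only [hfun]
    rw [← zIso_apply] at hL
    exact (hL.comp x zIso.toContinuousLinearEquiv.hasFDerivAt).const_smul (Real.pi : ℂ)⁻¹
  have hpi : (Real.pi : ℂ) ≠ 0 := by exact_mod_cast Real.pi_ne_zero
  have hx : zIso.symm (zOf x) = x := by rw [← zIso_apply, zIso.symm_apply_apply]
  rw [hx] at hLz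
  simp only [dzbarM, pdv, hd.fderiv, Matrix.of_apply]
  simp only [_root_.smul_apply, ContinuousLinearMap.comp_apply,
    ContinuousLinearEquiv.coe_coe, LinearIsometryEquiv.coe_toContinuousLinearEquiv, zIso_e1,
    zIso_e2, smul_eq_mul]
  field_simp
  linear_combination hLz

/-- Grönwall's inequality on a line, for a finite system with integrable coefficient bound
`K / (1 + s²)` and prescribed limit at `-∞`. -/
theorem norm_sq_le_of_deriv_bound {n : ℕ} {v w : Fin n → ℝ → ℂ} {l : Fin n → ℂ} {K : ℝ}
    (hd : ∀ i s, HasDerivAt (v i) (w i s) s)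
    (hw : ∀ i s, ‖w i s‖ ≤ K / (1 + s ^ 2) * ∑ k, ‖v k s‖)
    (hK : 0 ≤ K) (hl : ∀ i, Tendsto (v i) atBot (𝓝 (l i))) (hl1 : ∀ i, ‖l i‖ ≤ 1) (i : Fin n)
    (s : ℝ) : ‖v i s‖ ^ 2 ≤ n * Real.exp (2 * (n * K) * Real.pi) := by
  set F : ℝ → ℝ := fun s => ∑ i, ‖v i s‖ ^ 2 with hF
  set c : ℝ := 2 * (n * K) with hc
  have hc0 : 0 ≤ c := by positivity
  have hFd : ∀ s, HasDerivAt F (∑ i, 2 * inner ℝ (v i s) (w i s)) s := fun s =>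
    HasDerivAt.fun_sum fun i _ => (hd i s).norm_sq
  have hFb : ∀ s, ∑ i, 2 * inner ℝ (v i s) (w i s) ≤ c / (1 + s ^ 2) * F s := by
    intro s
    have h1 : ∀ i, 2 * inner ℝ (v i s) (w i s) ≤
        2 * (K / (1 + s ^ 2)) * (‖v i s‖ * ∑ k, ‖v k s‖) := fun i => by
      have := real_inner_le_norm (v i s) (w i s)
      have := mul_le_mul_of_nonneg_left (hw i s) (norm_nonneg (v i s))
      linarith
    have h2 := sq_sum_le_card_mul_sum_sq (s := Finset.univ) (f := fun k => ‖v k s‖)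
    simp only [Finset.card_univ, Fintype.card_fin] at h2
    calc ∑ i, 2 * inner ℝ (v i s) (w i s)
        ≤ ∑ i, 2 * (K / (1 + s ^ 2)) * (‖v i s‖ * ∑ k, ‖v k s‖) :=
          Finset.sum_le_sum fun i _ => h1 i
      _ = 2 * (K / (1 + s ^ 2)) * (∑ k, ‖v k s‖) ^ 2 := by
          rw [← Finset.mul_sum, ← Finset.sum_mul]; ring
      _ ≤ 2 * (K / (1 + s ^ 2)) * (n * F s) := by gcongr
      _ = c / (1 + s ^ 2) * F s := by rw [hc]; ring
  set H : ℝ → ℝ := fun s => F s * Real.exp (-c * Real.arctan s) with hH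
  have hHd : ∀ s, HasDerivAt H ((∑ i, 2 * inner ℝ (v i s) (w i s)) *
      Real.exp (-c * Real.arctan s) + F s * (Real.exp (-c * Real.arctan s) *
        (-c * (1 / (1 + s ^ 2))))) s := fun s =>
    (hFd s).mul ((Real.hasDerivAt_arctan s).const_mul (-c)).exp
  have hanti : Antitone H := antitone_of_hasDerivAt_nonpos hHd fun s => by
    have := mul_le_mul_of_nonneg_right (hFb s) (Real.exp_pos (-c * Real.arctan s)).le
    have e : F s * (Real.exp (-c * Real.arctan s) * (-c * (1 / (1 + s ^ 2)))) =
      -(c / (1 + s ^ 2) * F s * Real.exp (-c * Real.arctan s)) := by ring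
    simp only [e]
    change _ ≤ (0 : ℝ)
    linarith
  have hlim : Tendsto H atBot (𝓝 ((∑ i, ‖l i‖ ^ 2) * Real.exp (-c * -(Real.pi / 2)))) := by
    refine Tendsto.mul (tendsto_finsetSum _ fun i _ => (hl i).norm.pow 2) ?_
    refine (Real.continuous_exp.tendsto _).comp (Tendsto.const_mul _ ?_)
    exact tendsto_nhds_of_tendsto_nhdsWithin Real.tendsto_arctan_atBot
  have hle := hanti.ge_of_tendsto hlim s
  have hsum : ∑ i, ‖l i‖ ^ 2 ≤ n := by
    calc ∑ i, ‖l i‖ ^ 2 ≤ ∑ _i : Fin n, (1 : ℝ) :=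
          Finset.sum_le_sum fun i _ => pow_le_one₀ (norm_nonneg _) (hl1 i)
      _ = n := by simp
  have hvi : ‖v i s‖ ^ 2 ≤ F s :=
    Finset.single_le_sum (f := fun i => ‖v i s‖ ^ 2) (fun i _ => by positivity) (Finset.mem_univ i)
  have hFs : F s = H s * Real.exp (c * Real.arctan s) := by
    simp only [hH]
    rw [mul_assoc, ← Real.exp_add]; simp
  calc ‖v i s‖ ^ 2 ≤ F s := hvi
    _ = H s * Real.exp (c * Real.arctan s) := hFs
    _ ≤ (n * Real.exp (-c * -(Real.pi / 2))) * Real.exp (c * (Real.pi / 2)) := by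
        have := (Real.arctan_lt_pi_div_two s).le
        have hH' : H s ≤ n * Real.exp (-c * -(Real.pi / 2)) :=
          hle.trans (mul_le_mul_of_nonneg_right hsum (Real.exp_pos _).le)
        gcongr
    _ = n * Real.exp (c * Real.pi) := by
        rw [mul_assoc, ← Real.exp_add]; congr 2; ring

theorem exp_neg_mul_abs_le {δ : ℝ} (hδ : 0 < δ) (s : ℝ) :
    Real.exp (-δ * |s|) ≤ (1 + 2 / δ ^ 2) / (1 + s ^ 2) := by
  have h := Real.quadratic_le_exp_of_nonneg (x := δ * |s|) (by positivity)
  have hs : δ ^ 2 * s ^ 2 / 2 ≤ Real.exp (δ * |s|) := by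
    rw [mul_pow, sq_abs] at h
    have : 0 ≤ δ * |s| := by positivity
    linarith
  have h1 : 1 ≤ Real.exp (δ * |s|) := Real.one_le_exp (by positivity)
  rw [neg_mul, Real.exp_neg, le_div_iff₀ (by positivity), inv_mul_le_iff₀ (Real.exp_pos _)]
  have : s ^ 2 ≤ 2 / δ ^ 2 * Real.exp (δ * |s|) := by
    rw [div_mul_eq_mul_div, le_div_iff₀ (by positivity)]
    linarith
  linarith

theorem contDiffOn_inv_apply {m : ℕ} {𝕜 E : Type*} [NontriviallyNormedField 𝕜] [NormedAlgebra 𝕜 ℂ]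
    [NormedAddCommGroup E] [NormedSpace 𝕜 E] {n : WithTop ℕ∞} {s : Set E} {f : E → Mat m}
    (hf : ∀ i j, ContDiffOn 𝕜 n (fun x => f x i j) s) (hdet : ∀ x ∈ s, (f x).det ≠ 0)
    (i j : Fin m) : ContDiffOn 𝕜 n (fun x => (f x)⁻¹ i j) s := by
  have hd : ∀ g : E → Mat m, (∀ i j, ContDiffOn 𝕜 n (fun x => g x i j) s) →
      ContDiffOn 𝕜 n (fun x => (g x).det) s := by
    intro g hg
    simp only [Matrix.det_apply']
    exact ContDiffOn.sum fun σ _ => contDiffOn_const.mul (contDiffOn_prod fun k _ => hg _ _)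
  have ha : ContDiffOn 𝕜 n (fun x => (f x).adjugate i j) s := by
    simp only [Matrix.adjugate_apply]
    refine hd _ fun k l => ?_
    by_cases hk : k = j
    · subst hk
      simpa using contDiffOn_const
    · simpa [Matrix.updateRow_ne hk] using hf k l
  have he : (fun x => (f x)⁻¹ i j) = fun x => ((f x).det)⁻¹ * (f x).adjugate i j := by
    funext x
    simp [Matrix.inv_def, Ring.inverse_eq_inv']
  rw [he]
  exact ((hd f hf).inv hdet).mul ha

theorem tendsto_inv_apply {m : ℕ} {α : Type*} {l : Filter α} {f : α → Mat m}
    (hf : ∀ i j, Tendsto (fun x => f x i j) l (𝓝 ((1 : Mat m) i j))) (i j : Fin m) :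
    Tendsto (fun x => (f x)⁻¹ i j) l (𝓝 ((1 : Mat m) i j)) := by
  have hf' : Tendsto f l (𝓝 1) := tendsto_pi_nhds.2 fun i => tendsto_pi_nhds.2 fun j => hf i j
  have hdet : Tendsto (fun x => (f x).det) l (𝓝 1) := by
    have h := ((continuous_id.matrix_det).tendsto (1 : Mat m)).comp hf'
    rwa [id, Matrix.det_one] at h
  have hadj : Tendsto (fun x => (f x).adjugate i j) l (𝓝 ((1 : Mat m) i j)) := by
    have h := ((continuous_id.matrix_adjugate.matrix_elem i j).tendsto (1 : Mat m)).comp hf'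
    rwa [id, Matrix.adjugate_one] at h
  have := (hdet.inv₀ one_ne_zero).mul hadj
  simpa [Matrix.inv_def, Ring.inverse_eq_inv'] using this

theorem norm_mul_apply_le {m : ℕ} {A B : Mat m} {a b : ℝ} (hA : ∀ i j, ‖A i j‖ ≤ a)
    (hB : ∀ i j, ‖B i j‖ ≤ b) (i j : Fin m) : ‖(A * B) i j‖ ≤ m * (a * b) := by
  rw [Matrix.mul_apply]
  calc ‖∑ k, A i k * B k j‖ ≤ ∑ _k : Fin m, a * b := norm_sum_le_of_le _ fun k _ => by
        rw [norm_mul]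
        exact mul_le_mul (hA i k) (hB k j) (norm_nonneg _) ((norm_nonneg _).trans (hA i k))
    _ = m * (a * b) := by simp

theorem zeta1_of_norm_eq_one {t : ℂ} (ht : ‖t‖ = 1) : zeta1 t = t.re := by
  rw [zeta1, Complex.inv_eq_conj ht, Complex.add_conj]; push_cast; ring

theorem zeta2_of_norm_eq_one {t : ℂ} (ht : ‖t‖ = 1) : zeta2 t = t.im := by
  rw [zeta2, Complex.inv_eq_conj ht, Complex.sub_conj]; push_cast
  have := Complex.I_ne_zero
  field_simp

/-- On the unit circle the equation for `c` is a transport equation along a real direction, which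
bounds `c` and `c⁻¹` uniformly in the spectral parameter. -/
theorem exists_bound_of_transport {m : ℕ} {A1 A2 : R2 → Mat m} {C δ : ℝ} (hδ : 0 < δ)
    (hA1 : ∀ x i j, ‖A1 x i j‖ ≤ C * Real.exp (-δ * ‖x‖))
    (hA2 : ∀ x i j, ‖A2 x i j‖ ≤ C * Real.exp (-δ * ‖x‖)) :
    ∃ M : ℝ, ∀ t : ℂ, ‖t‖ = 1 → ∀ c : R2 → Mat m, (∀ i j, ContDiff ℝ 1 fun x => c x i j) →
      (∀ x, (c x).det ≠ 0) →
      (∀ x, zDirM (zeta1 t) (zeta2 t) c x =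
        (-Complex.I) • ((zeta1 t • A1 x + zeta2 t • A2 x) * c x)) →
      (∀ i j, Tendsto (fun x => c x i j) (Bornology.cobounded R2) (𝓝 ((1 : Mat m) i j))) →
      ∀ x i j, ‖c x i j‖ ≤ M ∧ ‖(c x)⁻¹ i j‖ ≤ M := by
  set K : ℝ := 2 * |C| * (1 + 2 / δ ^ 2) with hK
  have hK0 : 0 ≤ K := by positivity
  refine ⟨√(m * Real.exp (2 * (m * K) * Real.pi)), ?_⟩
  intro t ht c hc hdet heq hlim x i j
  set θ : R2 := t.re • e1 + t.im • e2 with hθ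
  have hθn : ‖θ‖ = 1 := by
    rw [← zIso.norm_map, hθ, map_add, map_smul, map_smul, zIso_e1, zIso_e2]
    simpa [Complex.re_add_im] using ht
  set s0 : ℝ := inner ℝ x θ with hs0
  set p : ℝ → R2 := fun s => (x - s0 • θ) + s • θ with hp
  have hps0 : p s0 = x := by simp [hp]
  have hpn : ∀ s, |s| ≤ ‖p s‖ := by
    intro s
    have h1 : inner ℝ (p s) θ = s := by
      simp [hp, inner_add_left, inner_sub_left, inner_smul_left, hθn, hs0]
    have h2 := abs_real_inner_le_norm (p s) θ
    rwa [h1, hθn, mul_one] at h2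
  have hptend : Tendsto p atBot (Bornology.cobounded R2) := by
    rw [← tendsto_norm_atTop_iff_cobounded]
    exact tendsto_atTop_mono hpn tendsto_abs_atBot_atTop
  have hpd : ∀ s, HasDerivAt p θ s := fun s => by
    exact (((hasDerivAt_id s).smul_const θ).const_add (x - s0 • θ)).congr_deriv (one_smul ℝ θ)
  set N : R2 → Mat m := fun y => zeta1 t • A1 y + zeta2 t • A2 y with hN
  have hNb : ∀ s k l, ‖N (p s) k l‖ ≤ K / (1 + s ^ 2) := by
    intro s k l
    have hre : ‖zeta1 t‖ ≤ 1 := by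
      rw [zeta1_of_norm_eq_one ht, Complex.norm_real, ← ht]; exact Complex.abs_re_le_norm t
    have him : ‖zeta2 t‖ ≤ 1 := by
      rw [zeta2_of_norm_eq_one ht, Complex.norm_real, ← ht]; exact Complex.abs_im_le_norm t
    have hexp : C * Real.exp (-δ * ‖p s‖) ≤ |C| * ((1 + 2 / δ ^ 2) / (1 + s ^ 2)) := by
      refine mul_le_mul (le_abs_self C) (le_trans (Real.exp_le_exp.2 ?_) (exp_neg_mul_abs_le hδ s))
        (Real.exp_pos _).le (abs_nonneg C)
      nlinarith [hpn s]
    have e1 : ‖zeta1 t * A1 (p s) k l‖ ≤ |C| * ((1 + 2 / δ ^ 2) / (1 + s ^ 2)) := by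
      rw [norm_mul]
      exact (mul_le_of_le_one_left (norm_nonneg _) hre).trans ((hA1 _ k l).trans hexp)
    have e2 : ‖zeta2 t * A2 (p s) k l‖ ≤ |C| * ((1 + 2 / δ ^ 2) / (1 + s ^ 2)) := by
      rw [norm_mul]
      exact (mul_le_of_le_one_left (norm_nonneg _) him).trans ((hA2 _ k l).trans hexp)
    calc ‖N (p s) k l‖ = ‖zeta1 t * A1 (p s) k l + zeta2 t * A2 (p s) k l‖ := by simp [hN]
      _ ≤ _ := (norm_add_le _ _).trans (add_le_add e1 e2)
      _ = K / (1 + s ^ 2) := by rw [hK]; ring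
  have hcd : ∀ k l s, HasDerivAt (fun s => c (p s) k l)
      (((-Complex.I) • (N (p s) * c (p s))) k l) s := by
    intro k l s
    have h1 := (((hc k l).differentiable one_ne_zero) (p s)).hasFDerivAt.comp_hasDerivAt s (hpd s)
    refine h1.congr_deriv ?_
    rw [← heq (p s), zDirM, Matrix.of_apply, pdv, pdv, hθ, map_add, map_smul, map_smul,
      zeta1_of_norm_eq_one ht, zeta2_of_norm_eq_one ht]
    simp
  have hunit : ∀ y, IsUnit (c y).det := fun y => isUnit_iff_ne_zero.2 (hdet y)
  have hqdiff : ∀ k l, ContDiff ℝ 1 fun y => (c y)⁻¹ k l := fun k l =>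
    contDiffOn_univ.1 (contDiffOn_inv_apply (fun i j => (hc i j).contDiffOn)
      (fun y _ => hdet y) k l)
  have hqd : ∀ k l s, HasDerivAt (fun s => (c (p s))⁻¹ k l)
      ((Complex.I • ((c (p s))⁻¹ * N (p s))) k l) s := by
    intro k l s
    set Q' : Mat m := Matrix.of fun k l => fderiv ℝ (fun y => (c y)⁻¹ k l) (p s) θ with hQ'
    have hq : ∀ k l, HasDerivAt (fun s => (c (p s))⁻¹ k l) (Q' k l) s := fun k l =>
      (((hqdiff k l).differentiable one_ne_zero) (p s)).hasFDerivAt.comp_hasDerivAt s (hpd s)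
    have hprod : Q' * c (p s) + (c (p s))⁻¹ * ((-Complex.I) • (N (p s) * c (p s))) = 0 := by
      ext a b
      have h1 : HasDerivAt (fun s => ((c (p s))⁻¹ * c (p s)) a b)
          (∑ r, (Q' a r * c (p s) r b +
            (c (p s))⁻¹ a r * ((-Complex.I) • (N (p s) * c (p s))) r b)) s := by
        simp only [Matrix.mul_apply (M := (c (p _))⁻¹)]
        exact HasDerivAt.fun_sum fun r _ => (hq a r).mul (hcd r b s)
      have h2 : HasDerivAt (fun s => ((c (p s))⁻¹ * c (p s)) a b) 0 s := by
        simp only [Matrix.nonsing_inv_mul _ (hunit _)]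
        exact hasDerivAt_const _ _
      have h3 := h1.unique h2
      rw [Finset.sum_add_distrib] at h3
      rw [Matrix.add_apply, Matrix.mul_apply, Matrix.mul_apply, Matrix.zero_apply]
      exact h3
    have hQeq : Q' = Complex.I • ((c (p s))⁻¹ * N (p s)) := by
      have h4 : Q' * c (p s) = (Complex.I • ((c (p s))⁻¹ * N (p s))) * c (p s) := by
        rw [eq_neg_of_add_eq_zero_left hprod]
        simp [Matrix.mul_assoc]
      have h5 := congrArg (· * (c (p s))⁻¹) h4
      simpa [Matrix.mul_assoc, Matrix.mul_nonsing_inv _ (hunit _)] using h5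
    rw [← hQeq]
    exact hq k l
  have hone : ∀ k l : Fin m, ‖(1 : Mat m) k l‖ ≤ 1 := fun k l => by
    rw [Matrix.one_apply]; split_ifs <;> simp
  constructor
  · have h := norm_sq_le_of_deriv_bound (v := fun k s => c (p s) k j)
      (w := fun k s => ((-Complex.I) • (N (p s) * c (p s))) k j) (K := K)
      (fun k s => hcd k j s) ?_ hK0 (fun k => (hlim k j).comp hptend) (fun k => hone k j) i s0
    · simp only [hps0] at h
      exact Real.le_sqrt_of_sq_le h
    · intro k s
      rw [Matrix.smul_apply, norm_smul, norm_neg, Complex.norm_I, one_mul, Matrix.mul_apply,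
        Finset.mul_sum]
      exact norm_sum_le_of_le _ fun r _ => by
        rw [norm_mul]; exact mul_le_mul_of_nonneg_right (hNb s k r) (norm_nonneg _)
  · have h := norm_sq_le_of_deriv_bound (v := fun k s => (c (p s))⁻¹ i k)
      (w := fun k s => (Complex.I • ((c (p s))⁻¹ * N (p s))) i k) (K := K)
      (fun k s => hqd i k s) ?_ hK0 (fun k => (tendsto_inv_apply hlim i k).comp hptend)
      (fun k => hone i k) j s0
    · simp only [hps0] at h
      exact Real.le_sqrt_of_sq_le h
    · intro k s
      rw [Matrix.smul_apply, norm_smul, Complex.norm_I, one_mul, Matrix.mul_apply,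
        Finset.mul_sum]
      exact norm_sum_le_of_le _ fun r _ => by
        rw [norm_mul, mul_comm]; exact mul_le_mul_of_nonneg_right (hNb s r k) (norm_nonneg _)

theorem extInf_zero {m : ℕ} (F : ℂ → Mat m) (L : Mat m) : extInf F L 0 = L := if_pos rfl

theorem extInf_of_ne {m : ℕ} (F : ℂ → Mat m) (L : Mat m) {s : ℂ} (hs : s ≠ 0) :
    extInf F L s = F s⁻¹ := if_neg hs

theorem one_le_norm_inv {s : ℂ} (hs : s ≠ 0) (h : ‖s‖ ≤ 1) : 1 ≤ ‖s⁻¹‖ := by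
  rw [norm_inv]
  exact (one_le_inv₀ (norm_pos_iff.2 hs)).2 h

theorem diffContOnCl_extInf {m : ℕ} {F : ℂ → Mat m} {L : Mat m} {i j : Fin m}
    (hc : ContinuousOn (fun t => F t i j) {t | 1 ≤ ‖t‖})
    (hd : DifferentiableOn ℂ (fun t => F t i j) {t | 1 < ‖t‖})
    (ha : AnalyticAt ℂ (fun s => extInf F L s i j) 0) :
    DiffContOnCl ℂ (fun s => extInf F L s i j) (Metric.ball 0 1) := by
  have hev : ∀ s : ℂ, s ≠ 0 →
      (fun s => F s⁻¹ i j) =ᶠ[𝓝 s] fun s => extInf F L s i j := fun s hs => by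
    filter_upwards [isOpen_ne.mem_nhds hs] with u hu
    rw [extInf_of_ne F L hu]
  refine ⟨fun s hs => ?_, ?_⟩
  · rcases eq_or_ne s 0 with rfl | h0
    · exact ha.differentiableAt.differentiableWithinAt
    · have hlt : 1 < ‖s⁻¹‖ := by
        rw [norm_inv]
        exact (one_lt_inv₀ (norm_pos_iff.2 h0)).2 (by simpa using hs)
      have h1 : DifferentiableAt ℂ (fun t => F t i j) s⁻¹ :=
        (hd _ hlt).differentiableAt ((isOpen_lt continuous_const continuous_norm).mem_nhds hlt)
      exact ((h1.comp s (differentiableAt_inv h0)).congr_of_eventuallyEq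
        (hev s h0).symm).differentiableWithinAt
  · rw [closure_ball 0 one_ne_zero]
    intro s hs
    rcases eq_or_ne s 0 with rfl | h0
    · exact ha.continuousAt.continuousWithinAt
    · have hs1 : ‖s‖ ≤ 1 := by simpa using hs
      have h2 : ContinuousWithinAt (fun s => F s⁻¹ i j) (Metric.closedBall 0 1 ∩ {u | u ≠ 0}) s :=
        ContinuousWithinAt.comp (hc _ (one_le_norm_inv h0 hs1))
          (continuousAt_inv₀ h0).continuousWithinAt
          fun u hu => one_le_norm_inv hu.2 (by simpa using hu.1)
      rw [continuousWithinAt_inter (isOpen_ne.mem_nhds h0)] at h2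
      exact h2.congr_of_eventuallyEq (((hev s h0).symm).filter_mono nhdsWithin_le_nhds)
        (by rw [extInf_of_ne F L h0])

theorem diffContOnCl_inv_apply {m : ℕ} {W : ℂ → Mat m}
    (hW : ∀ i j, DiffContOnCl ℂ (fun s => W s i j) (Metric.ball 0 1))
    (hdet : ∀ s, ‖s‖ ≤ 1 → (W s).det ≠ 0) (i j : Fin m) :
    DiffContOnCl ℂ (fun s => (W s)⁻¹ i j) (Metric.ball 0 1) := by
  have hcl : closure (Metric.ball (0 : ℂ) 1) = Metric.closedBall 0 1 := closure_ball 0 one_ne_zero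
  refine ⟨(contDiffOn_inv_apply (n := 1) (fun i j =>
    (hW i j).differentiableOn.contDiffOn Metric.isOpen_ball) (fun s hs => hdet s ?_)
    i j).differentiableOn one_ne_zero, ?_⟩
  · exact le_of_lt (by simpa using hs)
  · refine contDiffOn_zero.1 (contDiffOn_inv_apply (𝕜 := ℂ) (n := 0) (fun i j =>
      contDiffOn_zero.2 (hW i j).continuousOn) (fun s hs => hdet s ?_) i j)
    rw [hcl] at hs
    simpa using hs

theorem norm_le_of_sphere {f : ℂ → ℂ} (hf : DiffContOnCl ℂ f (Metric.ball 0 1)) {M : ℝ}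
    (hM : ∀ s, ‖s‖ = 1 → ‖f s‖ ≤ M) {s : ℂ} (hs : ‖s‖ ≤ 1) : ‖f s‖ ≤ M := by
  refine Complex.norm_le_of_forall_mem_frontier_norm_le Metric.isBounded_ball hf (fun z hz => ?_) ?_
  · rw [frontier_ball 0 one_ne_zero] at hz
    exact hM z (by simpa using hz)
  · rw [closure_ball 0 one_ne_zero]; simpa using hs

theorem integral_circle_inv {f : ℂ → ℂ} (hf : DifferentiableOn ℂ f (Metric.ball 0 1)) {ρ : ℝ}
    (hρ : 1 < ρ) : ∫ φ in (0 : ℝ)..(2 * Real.pi), f ((ρ : ℂ) * Complex.exp (Complex.I * φ))⁻¹ =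
      2 * Real.pi * f 0 := by
  have hρ0 : 0 < ρ := by linarith
  have hd : DiffContOnCl ℂ f (Metric.ball 0 |ρ⁻¹|) := by
    refine DifferentiableOn.diffContOnCl_ball (U := Metric.ball 0 1) hf fun s hs => ?_
    rw [abs_of_pos (inv_pos.2 hρ0)] at hs
    have h1 : ‖s‖ ≤ ρ⁻¹ := by simpa using hs
    have h2 : ρ⁻¹ < 1 := inv_lt_one_of_one_lt₀ hρ
    simpa using h1.trans_lt h2
  have hm := hd.circleAverage
  rw [Real.circleAverage_def] at hm
  have hmap : ∀ φ : ℝ, ((ρ : ℂ) * Complex.exp (Complex.I * φ))⁻¹ = circleMap 0 ρ⁻¹ (-φ) := by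
    intro φ
    rw [circleMap, mul_inv, ← Complex.exp_neg]
    push_cast
    rw [zero_add]; congr 2; ring
  have hper : Function.Periodic (fun φ => f (circleMap 0 ρ⁻¹ φ)) (2 * Real.pi) := fun φ => by
    simp only [periodic_circleMap 0 ρ⁻¹ φ]
  have hneg : ∫ φ in (0 : ℝ)..(2 * Real.pi), f (circleMap 0 ρ⁻¹ (-φ)) =
      ∫ φ in (0 : ℝ)..(2 * Real.pi), f (circleMap 0 ρ⁻¹ φ) := by
    rw [intervalIntegral.integral_comp_neg fun φ => f (circleMap 0 ρ⁻¹ φ)]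
    have := hper.intervalIntegral_add_eq (-(2 * Real.pi)) 0
    simpa using this
  simp only [hmap, hneg]
  rw [← hm, Complex.real_smul]
  have : (Real.pi : ℂ) ≠ 0 := by exact_mod_cast Real.pi_ne_zero
  push_cast
  field_simp

theorem contDiff_one_intervalIntegral {f : R2 × ℝ → ℂ} (hf : ContDiff ℝ 1 f) (a b : ℝ) :
    ContDiff ℝ 1 fun x => ∫ φ in a..b, f (x, φ) := by
  have hD : Continuous (fderiv ℝ f) := hf.continuous_fderiv one_ne_zero
  set f' : R2 → ℝ → R2 →L[ℝ] ℂ := fun x φ =>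
    (fderiv ℝ f (x, φ)).comp (ContinuousLinearMap.inl ℝ R2 ℝ) with hf'
  have hf'c : Continuous (Function.uncurry f') := hD.clm_comp continuous_const
  have hf'x : ∀ x, Continuous (f' x) := fun x => hf'c.comp (by fun_prop : Continuous fun φ => (x, φ))
  have hfx : ∀ x, Continuous fun φ => f (x, φ) := fun x => hf.continuous.comp (by fun_prop)
  rw [contDiff_one_iff_hasFDerivAt]
  refine ⟨fun x => ∫ φ in a..b, f' x φ,
    intervalIntegral.continuous_parametric_intervalIntegral_of_continuous' hf'c a b, fun x => ?_⟩
  obtain ⟨M, hM⟩ := ((isCompact_closedBall x 1).prod (isCompact_uIcc (a := a) (b := b))).exists_bound_of_continuousOn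
    hf'c.continuousOn
  refine intervalIntegral.hasFDerivAt_integral_of_dominated_of_fderiv_le
    (F := fun x φ => f (x, φ)) (F' := f') (bound := fun _ => M)
    (Metric.ball_mem_nhds x one_pos)
    (.of_forall fun x => (hfx x).aestronglyMeasurable)
    ((hfx x).intervalIntegrable a b) (hf'x x).aestronglyMeasurable
    (.of_forall fun φ hφ y hy => ?_) intervalIntegrable_const (.of_forall fun φ hφ y hy => ?_)
  · exact hM (y, φ) ⟨Metric.ball_subset_closedBall hy, Set.uIoc_subset_uIcc hφ⟩
  · exact ((hf.differentiable one_ne_zero) (y, φ)).hasFDerivAt.comp y (hasFDerivAt_prodMk_left y φ)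

theorem contDiff_comp_of_exterior {m : ℕ} {cp : R2 → ℂ → Mat m} {i j : Fin m}
    (hsm : ContDiffOn ℝ (⊤ : ℕ∞) (fun p : R2 × ℂ => cp p.1 p.2 i j) {p : R2 × ℂ | 1 ≤ ‖p.2‖})
    {E : Type*} [NormedAddCommGroup E] [NormedSpace ℝ E] {g : E → R2 × ℂ} (hg : ContDiff ℝ 1 g)
    (h1 : ∀ e, 1 ≤ ‖(g e).2‖) : ContDiff ℝ 1 fun e => cp (g e).1 (g e).2 i j :=
  (hsm.of_le (by exact_mod_cast le_top)).comp_contDiff hg h1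

theorem norm_circle_point {ρ : ℝ} (hρ : 1 < ρ) (φ : ℝ) :
    ‖(ρ : ℂ) * Complex.exp (Complex.I * φ)‖ = ρ := by
  rw [norm_mul, mul_comm Complex.I, Complex.norm_exp_ofReal_mul_I, mul_one, Complex.norm_real,
    Real.norm_of_nonneg (by linarith)]

theorem circle_point_ne_zero {ρ : ℝ} (hρ : 1 < ρ) (φ : ℝ) :
    (ρ : ℂ) * Complex.exp (Complex.I * φ) ≠ 0 := by
  rw [← norm_pos_iff, norm_circle_point hρ]; linarith

theorem contDiff_circle_point (ρ : ℝ) :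
    ContDiff ℝ 1 fun p : R2 × ℝ => (p.1, (ρ : ℂ) * Complex.exp (Complex.I * p.2)) := by
  refine contDiff_fst.prodMk (contDiff_const.mul (ContDiff.cexp (contDiff_const.mul ?_)))
  exact Complex.ofRealCLM.contDiff.comp contDiff_snd

/-- The value at infinity is an average over a circle, hence depends on `x` as smoothly as `cp`. -/
theorem contDiff_value_at_infinity {m : ℕ} {cp : R2 → ℂ → Mat m} {cpinf : R2 → Mat m}
    {i j : Fin m}
    (hsm : ContDiffOn ℝ (⊤ : ℕ∞) (fun p : R2 × ℂ => cp p.1 p.2 i j) {p : R2 × ℂ | 1 ≤ ‖p.2‖})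
    (hW : ∀ x, DiffContOnCl ℂ (fun s => extInf (cp x) (cpinf x) s i j) (Metric.ball 0 1)) :
    ContDiff ℝ 1 fun x => cpinf x i j := by
  have h2 : (1 : ℝ) < 2 := one_lt_two
  have heq : (fun x => cpinf x i j) = fun x => (2 * Real.pi : ℂ)⁻¹ *
      ∫ φ in (0 : ℝ)..(2 * Real.pi),
        cp x (((2 : ℝ) : ℂ) * Complex.exp (Complex.I * φ)) i j := by
    funext x
    have h := integral_circle_inv (hW x).differentiableOn h2
    simp only [extInf_zero, extInf_of_ne _ _ (inv_ne_zero (circle_point_ne_zero h2 _)),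
      inv_inv] at h
    have : (Real.pi : ℂ) ≠ 0 := by exact_mod_cast Real.pi_ne_zero
    rw [h]
    field_simp
  rw [heq]
  exact contDiff_const.mul (contDiff_one_intervalIntegral
    (contDiff_comp_of_exterior hsm (contDiff_circle_point 2)
      fun e => by simpa only [norm_circle_point h2] using h2.le) _ _)

theorem exists_bound_of_expDecay {m : ℕ} {δ : ℝ} {A : R2 → Mat m} (hA : ExpDecay δ A) :
    ∃ C : ℝ, ∀ x i j, ‖A x i j‖ ≤ C * Real.exp (-δ * ‖x‖) := by
  choose C hC using fun i j => (hA i j).2 0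
  simp only [norm_iteratedFDeriv_zero] at hC
  refine ⟨∑ i, ∑ j, |C i j|, fun x i j => (hC i j x).trans ?_⟩
  gcongr
  calc C i j ≤ |C i j| := le_abs_self _
    _ ≤ ∑ j, |C i j| := Finset.single_le_sum (f := fun j => |C i j|)
        (fun _ _ => abs_nonneg _) (Finset.mem_univ j)
    _ ≤ _ := Finset.single_le_sum (f := fun i => ∑ j, |C i j|)
        (fun _ _ => Finset.sum_nonneg fun _ _ => abs_nonneg _) (Finset.mem_univ i)

/-- Uniform bounds on the closed unit disc in `s = 1 / t`, by the maximum principle. -/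
theorem exists_bound_extInf {m : ℕ} {δ : ℝ} (hδ : 0 < δ) {A1 A2 : R2 → Mat m}
    (hA1 : ExpDecay δ A1) (hA2 : ExpDecay δ A2) {cp : R2 → ℂ → Mat m} {cpinf : R2 → Mat m}
    (hsm : ∀ i j, ContDiffOn ℝ (⊤ : ℕ∞) (fun p : R2 × ℂ => cp p.1 p.2 i j)
      {p : R2 × ℂ | 1 ≤ ‖p.2‖})
    (hdet : ∀ (x : R2) (t : ℂ), 1 ≤ ‖t‖ → (cp x t).det ≠ 0)
    (heq : ∀ (x : R2) (t : ℂ), 1 ≤ ‖t‖ →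
      zDirM (zeta1 t) (zeta2 t) (fun y => cp y t) x =
        (-Complex.I) • ((zeta1 t • A1 x + zeta2 t • A2 x) * cp x t))
    (hlim : ∀ t : ℂ, 1 ≤ ‖t‖ → ∀ i j,
      Filter.Tendsto (fun x : R2 => cp x t i j) (Bornology.cobounded R2)
        (nhds ((1 : Mat m) i j)))
    (hW : ∀ x i j, DiffContOnCl ℂ (fun s => extInf (cp x) (cpinf x) s i j) (Metric.ball 0 1))
    (hWi : ∀ x i j,
      DiffContOnCl ℂ (fun s => (extInf (cp x) (cpinf x) s)⁻¹ i j) (Metric.ball 0 1)) :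
    ∃ M : ℝ, ∀ x s, ‖s‖ ≤ 1 → ∀ i j, ‖extInf (cp x) (cpinf x) s i j‖ ≤ M ∧
      ‖(extInf (cp x) (cpinf x) s)⁻¹ i j‖ ≤ M := by
  obtain ⟨C1, hC1⟩ := exists_bound_of_expDecay hA1
  obtain ⟨C2, hC2⟩ := exists_bound_of_expDecay hA2
  obtain ⟨M, hM⟩ := exists_bound_of_transport (A1 := A1) (A2 := A2) (C := max C1 C2) hδ
    (fun x i j => (hC1 x i j).trans (by gcongr; exact le_max_left _ _))
    (fun x i j => (hC2 x i j).trans (by gcongr; exact le_max_right _ _))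
  have hcirc : ∀ x s, ‖s‖ = 1 → ∀ i j, ‖extInf (cp x) (cpinf x) s i j‖ ≤ M ∧
      ‖(extInf (cp x) (cpinf x) s)⁻¹ i j‖ ≤ M := by
    intro x s hs i j
    have hs0 : s ≠ 0 := by rw [← norm_pos_iff, hs]; exact one_pos
    have ht : ‖s⁻¹‖ = 1 := by rw [norm_inv, hs, inv_one]
    rw [extInf_of_ne _ _ hs0]
    exact hM s⁻¹ ht (fun y => cp y s⁻¹)
      (fun i j => contDiff_comp_of_exterior (hsm i j) (contDiff_id.prodMk contDiff_const)
        fun _ => ht.ge)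
      (fun y => hdet y _ ht.ge) (fun y => heq y _ ht.ge) (hlim _ ht.ge) x i j
  exact ⟨M, fun x s hs i j =>
    ⟨norm_le_of_sphere (hW x i j) (fun s hs => (hcirc x s hs i j).1) hs,
      norm_le_of_sphere (hWi x i j) (fun s hs => (hcirc x s hs i j).2) hs⟩⟩

theorem norm_mul_sub_le_ker (w : ℂ) (s : ℂ) :
    (1 - ‖s‖ ^ 2) * ‖w‖ ≤ ‖w + s ^ 2 * (starRingEnd ℂ) w‖ := by
  have h := norm_sub_norm_le w (-(s ^ 2 * (starRingEnd ℂ) w))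
  rw [norm_neg, sub_neg_eq_add, norm_mul, norm_pow, RCLike.norm_conj] at h
  linarith

theorem integrable_div_of_bound {δ : ℝ} (hδ : 0 < δ) {x : R2} {f k : R2 → ℂ} (hf : Continuous f)
    (hk : Continuous k) {C c : ℝ} (hc : 0 < c) (hC : ∀ y, ‖f y‖ ≤ C * Real.exp (-δ * ‖y‖))
    (hkc : ∀ y, c * ‖zOf x - zOf y‖ ≤ ‖k y‖) : Integrable fun y => f y / k y := by
  refine ((integrable_exp_neg_mul_norm_mul_inv_zOf hδ x).const_mul (C * c⁻¹)).mono'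
    (hf.measurable.div hk.measurable).aestronglyMeasurable ((Measure.ae_ne volume x).mono
      fun y hy => ?_)
  have hpos : 0 < ‖zOf x - zOf y‖ := norm_pos_iff.2 (zOf_sub_ne_zero (Ne.symm hy))
  rw [norm_div, div_eq_mul_inv]
  calc ‖f y‖ * ‖k y‖⁻¹ ≤ (C * Real.exp (-δ * ‖y‖)) * (c * ‖zOf x - zOf y‖)⁻¹ := by
        gcongr
        · exact (norm_nonneg _).trans (hC y)
        · exact hC y
        · exact hkc y
    _ = _ := by rw [mul_inv]; ring

/-- Averaging over the circle `|t| = ρ` replaces `s = 1 / t` by `0` in the kernel. -/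
theorem integral_circle_integral_div {δ : ℝ} (hδ : 0 < δ) {ρ : ℝ} (hρ : 1 < ρ) (x : R2)
    {N : R2 → ℂ → ℂ} (hN : ∀ y, DifferentiableOn ℂ (N y) (Metric.ball 0 1)) {C : ℝ}
    (hC : ∀ y s, ‖s‖ ≤ 1 → ‖N y s‖ ≤ C * Real.exp (-δ * ‖y‖))
    (hcont : Continuous fun p : R2 × ℝ => N p.1 ((ρ : ℂ) * Complex.exp (Complex.I * p.2))⁻¹) :
    ∫ φ in (0 : ℝ)..(2 * Real.pi), ∫ y : R2, N y ((ρ : ℂ) * Complex.exp (Complex.I * φ))⁻¹ /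
        (zOf x - zOf y + ((ρ : ℂ) * Complex.exp (Complex.I * φ))⁻¹ ^ 2 *
          (starRingEnd ℂ) (zOf x - zOf y)) =
      2 * Real.pi * ∫ y : R2, N y 0 / (zOf x - zOf y) := by
  set k : R2 → ℂ → ℂ := fun y s => zOf x - zOf y + s ^ 2 * (starRingEnd ℂ) (zOf x - zOf y) with hk
  set τ : ℝ → ℂ := fun φ => ((ρ : ℂ) * Complex.exp (Complex.I * φ))⁻¹ with hτ
  have hτn : ∀ φ, ‖τ φ‖ = ρ⁻¹ := fun φ => by rw [hτ, norm_inv, norm_circle_point hρ]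
  have hτ1 : ρ⁻¹ < 1 := inv_lt_one_of_one_lt₀ hρ
  have hτ0 : 0 < ρ⁻¹ := inv_pos.2 (by linarith)
  have hτc : Continuous τ :=
    Continuous.inv₀ (by fun_prop) fun φ => circle_point_ne_zero hρ φ
  have hc : 0 < 1 - ρ⁻¹ ^ 2 := by nlinarith
  have hkc : Continuous fun p : R2 × ℝ => k p.1 (τ p.2) := by
    have := continuous_zOf.comp (continuous_fst (X := R2) (Y := ℝ))
    have h2 := hτc.comp (continuous_snd (X := R2) (Y := ℝ))
    have h3 : Continuous fun p : R2 × ℝ => zOf x - zOf p.1 := continuous_const.sub this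
    exact h3.add ((h2.pow 2).mul (Complex.continuous_conj.comp h3))
  have hkle : ∀ y φ, (1 - ρ⁻¹ ^ 2) * ‖zOf x - zOf y‖ ≤ ‖k y (τ φ)‖ := fun y φ => by
    rw [← hτn φ]; exact norm_mul_sub_le_ker _ _
  have : IsFiniteMeasure (volume.restrict (Set.uIoc 0 (2 * Real.pi))) := ⟨by simp [Set.uIoc]⟩
  have hint : Integrable (Function.uncurry fun (φ : ℝ) (y : R2) => N y (τ φ) / k y (τ φ))
      ((volume.restrict (Set.uIoc 0 (2 * Real.pi))).prod volume) := by
    have hd := (((integrable_exp_neg_mul_norm_mul_inv_zOf hδ x).const_mul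
      (C * (1 - ρ⁻¹ ^ 2)⁻¹)).comp_snd (volume.restrict (Set.uIoc 0 (2 * Real.pi))))
    refine hd.mono' ?_ ?_
    · exact ((hcont.comp continuous_swap).measurable.div
        (hkc.comp continuous_swap).measurable).aestronglyMeasurable
    · have hae : ∀ᵐ p : ℝ × R2 ∂((volume.restrict (Set.uIoc 0 (2 * Real.pi))).prod volume),
          p.2 ≠ x := Measure.quasiMeasurePreserving_snd.ae (Measure.ae_ne volume x)
      filter_upwards [hae] with p hp
      have hpos : 0 < ‖zOf x - zOf p.2‖ := norm_pos_iff.2 (zOf_sub_ne_zero (Ne.symm hp))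
      have hCp := hC p.2 (τ p.1) ((hτn p.1).trans_le hτ1.le)
      rw [Function.uncurry, norm_div, div_eq_mul_inv]
      calc ‖N p.2 (τ p.1)‖ * ‖k p.2 (τ p.1)‖⁻¹
          ≤ (C * Real.exp (-δ * ‖p.2‖)) * ((1 - ρ⁻¹ ^ 2) * ‖zOf x - zOf p.2‖)⁻¹ := by
            gcongr
            · exact (norm_nonneg _).trans hCp
            · exact hkle _ _
        _ = _ := by rw [mul_inv]; ring
  have hswap := intervalIntegral_integral_swap hint
  rw [hswap, ← integral_const_mul]
  refine integral_congr_ae ((Measure.ae_ne volume x).mono fun y hy => ?_)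
  have hne := zOf_sub_ne_zero (Ne.symm hy)
  have hd : DifferentiableOn ℂ (fun s => N y s / k y s) (Metric.ball 0 1) := by
    refine (hN y).div (by fun_prop) fun s hs => ?_
    have hs1 : ‖s‖ < 1 := by simpa using hs
    refine norm_pos_iff.1 (lt_of_lt_of_le ?_ (norm_mul_sub_le_ker _ s))
    have := norm_pos_iff.2 hne
    have h0 := norm_nonneg s
    exact mul_pos (by nlinarith) this
  have := integral_circle_inv hd hρ
  simp only [hτ]
  rw [this]
  simp [hk]

theorem mul_of_integral_mul_apply {m : ℕ} {f : R2 → Mat m} {k : R2 → ℂ} (P Q : Mat m) (c : ℂ)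
    (hf : ∀ i j, Integrable fun y => f y i j / k y) (i j : Fin m) :
    (P * Matrix.of (fun i j => c * ∫ y, f y i j / k y) * Q) i j =
      c * ∫ y, (P * f y * Q) i j / k y := by
  have h : ∀ y, (P * f y * Q) i j / k y =
      ∑ l, ∑ l', P i l' * Q l j * (f y l' l / k y) := fun y => by
    simp only [Matrix.mul_apply, Finset.sum_mul, Finset.sum_div]
    refine Finset.sum_congr rfl fun l _ => Finset.sum_congr rfl fun l' _ => by ring
  simp only [h]
  rw [integral_finsetSum _ fun l _ => integrable_finsetSum _ fun l' _ => (hf l' l).const_mul _]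
  simp only [Matrix.mul_apply, Matrix.of_apply, Finset.sum_mul, Finset.mul_sum]
  refine Finset.sum_congr rfl fun l _ => ?_
  rw [integral_finsetSum _ fun l' _ => (hf l' l).const_mul _, Finset.mul_sum]
  refine Finset.sum_congr rfl fun l' _ => ?_
  rw [integral_const_mul]; ring

theorem ker_eq_mul {t : ℂ} (ht : t ≠ 0) (x y : R2) :
    ker t x y = t * (zOf x - zOf y + t⁻¹ ^ 2 * (starRingEnd ℂ) (zOf x - zOf y)) := by
  rw [_root_.ker]; field_simp

theorem norm_conj_apply_le {m : ℕ} {P R Q : Mat m} {M C e : ℝ}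
    (hP : ∀ i j, ‖P i j‖ ≤ M) (hR : ∀ i j, ‖R i j‖ ≤ C * e) (hQ : ∀ i j, ‖Q i j‖ ≤ M)
    (i j : Fin m) : ‖(P * R * Q) i j‖ ≤ m * (m * (M * C) * M) * e :=
  (norm_mul_apply_le (norm_mul_apply_le hP hR) hQ i j).trans_eq (by ring)

theorem continuous_nonsing_inv {m : ℕ} {X : Type*} [TopologicalSpace X] {f : X → Mat m}
    (hf : Continuous f) (hdet : ∀ x, (f x).det ≠ 0) : Continuous fun x => (f x)⁻¹ := by
  simp only [Matrix.inv_def, Ring.inverse_eq_inv']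
  exact (hf.matrix_det.inv₀ hdet).smul hf.matrix_adjugate

theorem DifferentiableOn.matrix_mul_apply {m : ℕ} {s : Set ℂ} {f g : ℂ → Mat m}
    (hf : ∀ i j, DifferentiableOn ℂ (fun u => f u i j) s)
    (hg : ∀ i j, DifferentiableOn ℂ (fun u => g u i j) s) (i j : Fin m) :
    DifferentiableOn ℂ (fun u => (f u * g u) i j) s := by
  simp only [Matrix.mul_apply]
  exact DifferentiableOn.fun_sum fun k _ => (hf i k).mul (hg k j)

/-- The contour integral over `|t| = ρ` in terms of the values at infinity. -/
theorem circIntM_eq_conj_CauchyM {m : ℕ} {δ : ℝ} (hδ : 0 < δ) {V : R2 → Mat m}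
    {cp : R2 → ℂ → Mat m} {cpinf : R2 → Mat m} {C M : ℝ}
    (hVc : ∀ i j, Continuous fun x => V x i j)
    (hV : ∀ x i j, ‖V x i j‖ ≤ C * Real.exp (-δ * ‖x‖))
    (hsm : ∀ i j, ContDiffOn ℝ (⊤ : ℕ∞) (fun p : R2 × ℂ => cp p.1 p.2 i j)
      {p : R2 × ℂ | 1 ≤ ‖p.2‖})
    (hdet : ∀ (x : R2) (t : ℂ), 1 ≤ ‖t‖ → (cp x t).det ≠ 0)
    (hdinf : ∀ x : R2, (cpinf x).det ≠ 0)
    (hW : ∀ x i j, DiffContOnCl ℂ (fun s => extInf (cp x) (cpinf x) s i j) (Metric.ball 0 1))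
    (hWi : ∀ x i j,
      DiffContOnCl ℂ (fun s => (extInf (cp x) (cpinf x) s)⁻¹ i j) (Metric.ball 0 1))
    (hM : ∀ x s, ‖s‖ ≤ 1 → ∀ i j, ‖extInf (cp x) (cpinf x) s i j‖ ≤ M ∧
      ‖(extInf (cp x) (cpinf x) s)⁻¹ i j‖ ≤ M)
    {ρ : ℝ} (hρ : 1 < ρ) (x : R2) :
    (2 * Real.pi * Complex.I : ℂ)⁻¹ • circIntM (fun t =>
        cp x t * PiTM t (fun y => (cp y t)⁻¹ * V y * cp y t) x * (cp x t)⁻¹) ρ =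
      cpinf x * CauchyM (fun y => (cpinf y)⁻¹ * V y * cpinf y) x * (cpinf x)⁻¹ := by
  have hcV : Continuous V := continuous_matrix hVc
  have hcinf : Continuous cpinf :=
    continuous_matrix fun i j => (contDiff_value_at_infinity (hsm i j) fun x => hW x i j).continuous
  have hccp : Continuous fun p : R2 × ℝ => cp p.1 ((ρ : ℂ) * Complex.exp (Complex.I * p.2)) :=
    continuous_matrix fun i j => (contDiff_comp_of_exterior (hsm i j) (contDiff_circle_point ρ)
      fun e => by simpa only [norm_circle_point hρ] using hρ.le).continuous
  have hdet' : ∀ x φ, (cp x ((ρ : ℂ) * Complex.exp (Complex.I * (φ : ℝ)))).det ≠ 0 := fun x φ =>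
    hdet x _ (by rw [norm_circle_point hρ]; exact hρ.le)
  set W : R2 → ℂ → Mat m := fun y s => extInf (cp y) (cpinf y) s with hWdef
  set N : R2 → ℂ → Mat m := fun y s => W x s * ((W y s)⁻¹ * V y * W y s) * (W x s)⁻¹ with hN
  have hG : ∀ y s, ‖s‖ ≤ 1 → ∀ i j, ‖((W y s)⁻¹ * V y * W y s) i j‖ ≤
      m * (m * (M * C) * M) * Real.exp (-δ * ‖y‖) := fun y s hs =>
    norm_conj_apply_le (fun i j => (hM y s hs i j).2) (hV y) (fun i j => (hM y s hs i j).1)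
  have hNb : ∀ y s, ‖s‖ ≤ 1 → ∀ i j, ‖N y s i j‖ ≤
      m * (m * (M * (m * (m * (M * C) * M))) * M) * Real.exp (-δ * ‖y‖) := fun y s hs =>
    norm_conj_apply_le (fun i j => (hM x s hs i j).1) (hG y s hs) (fun i j => (hM x s hs i j).2)
  have hNd : ∀ y i j, DifferentiableOn ℂ (fun s => N y s i j) (Metric.ball 0 1) := by
    intro y
    have h1 : ∀ y i j, DifferentiableOn ℂ (fun s => W y s i j) (Metric.ball 0 1) :=
      fun y i j => (hW y i j).differentiableOn
    have h2 : ∀ y i j, DifferentiableOn ℂ (fun s => (W y s)⁻¹ i j) (Metric.ball 0 1) :=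
      fun y i j => (hWi y i j).differentiableOn
    exact DifferentiableOn.matrix_mul_apply (DifferentiableOn.matrix_mul_apply (h1 x)
      (DifferentiableOn.matrix_mul_apply (DifferentiableOn.matrix_mul_apply (h2 y)
        fun i j => differentiableOn_const (V y i j)) (h1 y))) (h2 x)
  have hWt : ∀ y (φ : ℝ), W y ((ρ : ℂ) * Complex.exp (Complex.I * φ))⁻¹ =
      cp y ((ρ : ℂ) * Complex.exp (Complex.I * φ)) := fun y φ => by
    rw [hWdef]; simp only [extInf_of_ne _ _ (inv_ne_zero (circle_point_ne_zero hρ φ)), inv_inv]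
  have hW0 : ∀ y, W y 0 = cpinf y := fun y => extInf_zero _ _
  have hNc : Continuous fun p : R2 × ℝ =>
      N p.1 ((ρ : ℂ) * Complex.exp (Complex.I * p.2))⁻¹ := by
    simp only [hN, hWt]
    have hx : Continuous fun p : R2 × ℝ =>
        cp x ((ρ : ℂ) * Complex.exp (Complex.I * p.2)) :=
      hccp.comp (continuous_const.prodMk continuous_snd)
    exact (hx.mul (((continuous_nonsing_inv hccp fun p => hdet' _ _).mul (hcV.comp continuous_fst)).mul hccp)).mul
      (continuous_nonsing_inv hx fun p => hdet' _ _)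
  have hpi : (Real.pi : ℂ) ≠ 0 := by exact_mod_cast Real.pi_ne_zero
  have hsub : Continuous fun y => zOf x - zOf y := continuous_const.sub continuous_zOf
  ext i j
  have hR : (cpinf x * CauchyM (fun y => (cpinf y)⁻¹ * V y * cpinf y) x * (cpinf x)⁻¹) i j =
      (Real.pi : ℂ)⁻¹ * ∫ y, N y 0 i j / (zOf x - zOf y) := by
    rw [CauchyM, mul_of_integral_mul_apply]
    · simp only [hN, hW0]
    · intro i j
      refine integrable_div_of_bound hδ ?_ hsub one_pos (fun y => by
        simpa only [hW0] using hG y 0 (by simp) i j) fun y => by rw [one_mul]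
      exact (((continuous_nonsing_inv hcinf hdinf).mul hcV).mul hcinf).matrix_elem i j
  have hL : ∀ φ : ℝ, (cp x ((ρ : ℂ) * Complex.exp (Complex.I * φ)) *
        PiTM ((ρ : ℂ) * Complex.exp (Complex.I * φ)) (fun y =>
          (cp y ((ρ : ℂ) * Complex.exp (Complex.I * φ)))⁻¹ * V y *
            cp y ((ρ : ℂ) * Complex.exp (Complex.I * φ))) x *
        (cp x ((ρ : ℂ) * Complex.exp (Complex.I * φ)))⁻¹) i j *
        (Complex.I * ρ * Complex.exp (Complex.I * φ)) =
      Complex.I * (Real.pi : ℂ)⁻¹ *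
        ∫ y : R2, N y ((ρ : ℂ) * Complex.exp (Complex.I * φ))⁻¹ i j /
          (zOf x - zOf y + ((ρ : ℂ) * Complex.exp (Complex.I * φ))⁻¹ ^ 2 *
            (starRingEnd ℂ) (zOf x - zOf y)) := by
    intro φ
    have hNφ : ∀ y, N y ((ρ : ℂ) * Complex.exp (Complex.I * φ))⁻¹ = _ := fun y => by
      simp only [hN, hWt]; rfl
    have hGφ := fun y => hG y ((ρ : ℂ) * Complex.exp (Complex.I * φ))⁻¹
      (by rw [norm_inv, norm_circle_point hρ]; exact (inv_lt_one_of_one_lt₀ hρ).le)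
    simp only [hWt] at hGφ
    have hcφ := hccp.comp (Continuous.prodMk_left φ)
    have hdφ := fun y => hdet' y φ
    have htn := norm_circle_point hρ φ
    have ht0 := circle_point_ne_zero hρ φ
    rw [mul_assoc Complex.I]
    simp only [Function.comp_def] at hcφ
    generalize (ρ : ℂ) * Complex.exp (Complex.I * φ) = t at *
    rw [PiTM, mul_of_integral_mul_apply]
    · simp only [hNφ, ker_eq_mul ht0]
      rw [mul_mul_mul_comm, mul_comm (Real.pi : ℂ)⁻¹, ← integral_mul_const]
      simp only [mul_comm t, ← div_div, div_mul_cancel₀ _ ht0]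
    · intro i j
      refine integrable_div_of_bound hδ (x := x) (c := ρ * (1 - ρ⁻¹ ^ 2)) ?_ ?_ ?_
        (fun y => hGφ y i j) fun y => ?_
      · exact (((continuous_nonsing_inv hcφ hdφ).mul hcV).mul hcφ).matrix_elem i j
      · exact (continuous_const.mul hsub).add
          (continuous_const.mul (Complex.continuous_conj.comp hsub))
      · have h1 := inv_lt_one_of_one_lt₀ hρ
        have h0 : 0 < ρ⁻¹ := inv_pos.2 (by linarith)
        exact mul_pos (by linarith) (by nlinarith)
      · rw [ker_eq_mul ht0, norm_mul, htn, mul_assoc]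
        have := norm_mul_sub_le_ker (zOf x - zOf y) t⁻¹
        rw [norm_inv, htn] at this
        exact mul_le_mul_of_nonneg_left this (by linarith)
  rw [hR, Matrix.smul_apply, circIntM, Matrix.of_apply]
  simp only [hL]
  rw [intervalIntegral.integral_const_mul, integral_circle_integral_div hδ hρ x
    (N := fun y s => N y s i j) (fun y => hNd y i j) (fun y s hs => hNb y s hs i j)
    (hNc.matrix_elem i j), smul_eq_mul]
  have := Complex.I_ne_zero
  field_simp

/-- Recovery of the potential V from the contour integral of B₊ (formulas (4.25)–(4.27)). -/
theorem recover_V (m : ℕ) (hm : 1 ≤ m) (δ : ℝ) (hδ : 0 < δ)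
    (A1 A2 V : R2 → Mat m)
    (hA1 : ExpDecay δ A1) (hA2 : ExpDecay δ A2) (hV : ExpDecay δ V)
    -- Condition (A): the matrix c₊ on ℝ²×closure(D⁺)
    (cp : R2 → ℂ → Mat m) (cpinf : R2 → Mat m)
    (hsm : ∀ i j, ContDiffOn ℝ (⊤ : ℕ∞) (fun p : R2 × ℂ => cp p.1 p.2 i j)
      {p : R2 × ℂ | 1 ≤ ‖p.2‖})
    (hdet : ∀ (x : R2) (t : ℂ), 1 ≤ ‖t‖ → (cp x t).det ≠ 0)
    (han : ∀ x : R2, ∀ i j,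
      DifferentiableOn ℂ (fun t => cp x t i j) {t : ℂ | 1 < ‖t‖} ∧
      AnalyticAt ℂ (fun s => extInf (cp x) (cpinf x) s i j) 0)
    (hdinf : ∀ x : R2, (cpinf x).det ≠ 0)
    (heq : ∀ (x : R2) (t : ℂ), 1 ≤ ‖t‖ →
      zDirM (zeta1 t) (zeta2 t) (fun y => cp y t) x =
        (-Complex.I) • ((zeta1 t • A1 x + zeta2 t • A2 x) * cp x t))
    (hlim : ∀ t : ℂ, 1 ≤ ‖t‖ → ∀ i j,
      Filter.Tendsto (fun x : R2 => cp x t i j) (Bornology.cobounded R2)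
        (nhds ((1 : Mat m) i j)))
    (Bp : R2 → ℂ → Mat m)
    (hBp : ∀ (x : R2) (t : ℂ), Bp x t =
      cp x t * PiTM t (fun y => (cp y t)⁻¹ * V y * cp y t) x * (cp x t)⁻¹) :
    ∀ ρ : ℝ, 1 < ρ → ∀ x : R2,
      (2 * Real.pi * Complex.I : ℂ)⁻¹ • circIntM (fun t => Bp x t) ρ =
        cpinf x * CauchyM (fun y => (cpinf y)⁻¹ * V y * cpinf y) x * (cpinf x)⁻¹ ∧
      V x = cpinf x *
        dzbarM (fun y => (cpinf y)⁻¹ *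
          ((2 * Real.pi * Complex.I : ℂ)⁻¹ • circIntM (fun t => Bp y t) ρ) * cpinf y) x *
        (cpinf x)⁻¹ := by
  have hW : ∀ x i j,
      DiffContOnCl ℂ (fun s => extInf (cp x) (cpinf x) s i j) (Metric.ball 0 1) := by
    refine fun x i j => diffContOnCl_extInf ?_ (han x i j).1 (han x i j).2
    exact (hsm i j).continuousOn.comp (Continuous.prodMk_right x).continuousOn fun t ht => ht
  have hWdet : ∀ x s, ‖s‖ ≤ 1 → (extInf (cp x) (cpinf x) s).det ≠ 0 := by
    intro x s hs
    rcases eq_or_ne s 0 with rfl | h0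
    · rw [extInf_zero]; exact hdinf x
    · rw [extInf_of_ne _ _ h0]; exact hdet x _ (one_le_norm_inv h0 hs)
  have hWi := fun x => diffContOnCl_inv_apply (hW x) (hWdet x)
  obtain ⟨M, hM⟩ := exists_bound_extInf hδ hA1 hA2 hsm hdet heq hlim hW hWi
  obtain ⟨C, hC⟩ := exists_bound_of_expDecay hV
  have hmain : ∀ ρ : ℝ, 1 < ρ → ∀ x : R2,
      (2 * Real.pi * Complex.I : ℂ)⁻¹ • circIntM (fun t => Bp x t) ρ =
        cpinf x * CauchyM (fun y => (cpinf y)⁻¹ * V y * cpinf y) x * (cpinf x)⁻¹ := by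
    intro ρ hρ x
    simp only [hBp]
    exact circIntM_eq_conj_CauchyM hδ (fun i j => (hV i j).1.continuous) hC hsm hdet hdinf hW hWi
      hM hρ x
  have hl : ∀ x, (cpinf x)⁻¹ * cpinf x = 1 := fun x =>
    Matrix.nonsing_inv_mul _ (hdinf x).isUnit
  have hr : ∀ x, cpinf x * (cpinf x)⁻¹ = 1 := fun x =>
    Matrix.mul_nonsing_inv _ (hdinf x).isUnit
  intro ρ hρ x
  refine ⟨hmain ρ hρ x, ?_⟩
  have hfun : (fun y => (cpinf y)⁻¹ *
      ((2 * Real.pi * Complex.I : ℂ)⁻¹ • circIntM (fun t => Bp y t) ρ) * cpinf y) =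
      CauchyM fun y => (cpinf y)⁻¹ * V y * cpinf y := by
    funext y
    rw [hmain ρ hρ y]
    simp only [← Matrix.mul_assoc, hl, one_mul]
    rw [Matrix.mul_assoc, hl, mul_one]
  have hinf : ∀ i j, ContDiff ℝ 1 fun x => cpinf x i j := fun i j =>
    contDiff_value_at_infinity (hsm i j) fun x => hW x i j
  have hinv : ∀ i j, ContDiff ℝ 1 fun x => (cpinf x)⁻¹ i j := fun i j =>
    contDiffOn_univ.1 (contDiffOn_inv_apply (fun i j => (hinf i j).contDiffOn)
      (fun x _ => hdinf x) i j)
  have hVs : ∀ i j, ContDiff ℝ 1 fun x => V x i j := fun i j =>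
    (hV i j).1.of_le (by exact_mod_cast le_top)
  rw [hfun, dzbarM_CauchyM (C := m * (m * (M * C) * M)) (δ := δ) _ hδ]
  · simp only [← Matrix.mul_assoc, hr, one_mul]
    rw [Matrix.mul_assoc, hr, mul_one]
  · intro x i j
    have h := hM x 0 (by simp)
    simp only [extInf_zero] at h
    exact norm_conj_apply_le (fun i j => (h i j).2) (hC x) (fun i j => (h i j).1) i j
  · intro i j
    simp only [Matrix.mul_apply]
    exact ContDiff.sum fun k _ => (ContDiff.sum fun l _ => (hinv i l).mul (hVs l k)).mul (hinf k j)
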